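/- There exists a binary self-dual code 𝒞 ⊆ 𝔽₂^{94} of dimension 47 and minimum Hamming distance 16 whose weight enumerator satisfies A₁₆ = 2α, A₁₈ = 134044 − 2α + 128β and A₂₀ = 2010660 − 30α − 896β with α = 4646 and β = −92. -/

import Mathlib

/-- The Hamming weight of a binary vector. -/
def wt {m : ℕ} (x : Fin m → ZMod 2) : ℕ :=
  (Finset.univ.filter fun i => x i ≠ 0).card

/-! ### Bit-sliced enumeration of the sums of `k` rows -/

namespace BitSlice

/-- The bitwise sums of all `k`-element subfamilies of a list of bit masks. -/
def lanes : List ℕ → ℕ → List ℕ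
  | _, 0 => [0]
  | [], _ + 1 => []
  | r :: rs, k + 1 => lanes rs (k + 1) ++ (lanes rs k).map (Nat.xor · r)

/-- The length of `lanes`. -/
def num : List ℕ → ℕ → ℕ
  | _, 0 => 1
  | [], _ + 1 => 0
  | _ :: rs, k + 1 => Nat.add (num rs (k + 1)) (num rs k)

/-- The number whose lowest `n` bits are set. -/
def ones (n : ℕ) : ℕ := Nat.sub (Nat.shiftLeft 1 n) 1

/-- The `j`-th bit of `m`. -/
def bitOf (m j : ℕ) : Bool := Nat.beq (Nat.land (Nat.shiftRight m j) 1) 1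

/-- The number whose `i`-th bit is the `j`-th bit of the `i`-th entry of `lanes`. -/
def col (j : ℕ) : List ℕ → ℕ → ℕ
  | _, 0 => 0
  | [], _ + 1 => 0
  | r :: rs, k + 1 =>
    Nat.lor (col j rs (k + 1))
      (Nat.shiftLeft (bif bitOf r j then Nat.xor (col j rs k) (ones (num rs k)) else col j rs k)
        (num rs (k + 1)))

/-- Adds a carry to a bit-sliced vector of numbers. -/
def addCarry : List ℕ → ℕ → List ℕ
  | [], c => [c]
  | a :: as, c => Nat.xor a c :: addCarry as (Nat.land a c)

/-- Adds two bit-sliced vectors of numbers and a carry. -/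
def addWithCarry : List ℕ → List ℕ → ℕ → List ℕ
  | [], bs, c => addCarry bs c
  | a :: as, [], c => addCarry (a :: as) c
  | a :: as, b :: bs, c =>
    (fun d => Nat.xor d c :: addWithCarry as bs (Nat.lor (Nat.land a b) (Nat.land d c)))
      (Nat.xor a b)

/-- The bit-sliced sum of the bit vectors `f j`, for `j` in a tree of indices. -/
def bits (f : ℕ → ℕ) : BinaryTree ℕ → List ℕ
  | .nil => []
  | .node j l r => addWithCarry (bits f l) (bits f r) (f j)

/-- The lanes within the mask `m` whose bit-sliced number is `t`. -/
def eqMask (o : ℕ) : List ℕ → ℕ → ℕ → ℕ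
  | [], t, m => bif Nat.beq t 0 then m else 0
  | b :: bs, t, m =>
    eqMask o bs (Nat.div t 2) (Nat.land m (bif Nat.beq (Nat.mod t 2) 1 then b else Nat.xor b o))

/-- The number of bits set among the lowest `2 ^ n` ones. -/
def popCount : ℕ → ℕ → ℕ
  | 0, m => Nat.mod m 2
  | n + 1, m => bif Nat.beq m 0 then 0 else
      Nat.add (popCount n (Nat.mod m (Nat.shiftLeft 1 (Nat.shiftLeft 1 n))))
        (popCount n (Nat.shiftRight m (Nat.shiftLeft 1 n)))

/-- The number of lanes `v` for which `v + x` has weight `t`, computed in one batch. -/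
def batch (T : BinaryTree ℕ) (rs : List ℕ) (k x t : ℕ) : ℕ :=
  (fun o => popCount 20 (eqMask o
    (bits (fun j => bif bitOf x j then Nat.xor (col j rs k) o else col j rs k) T) t o))
    (ones (num rs k))

/-- The number of lanes `v` for which `v + x` has weight `t`, in batches of size at most `B`. -/
def count (T : BinaryTree ℕ) (B t : ℕ) : List ℕ → ℕ → ℕ → ℕ
  | rs, 0, x => batch T rs 0 x t
  | [], k + 1, x => batch T [] (k + 1) x t
  | r :: rs, k + 1, x => bif Nat.ble (num (r :: rs) (k + 1)) B then batch T (r :: rs) (k + 1) x t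
     else Nat.add (count T B t rs (k + 1) x) (count T B t rs k (Nat.xor x r))

/-- The sum of `count T B (w - k) rs k x` over all `k < m`. -/
def total (T : BinaryTree ℕ) (B w : ℕ) (rs : List ℕ) (x : ℕ) : ℕ → ℕ
  | 0 => 0
  | m + 1 => Nat.add (count T B (Nat.sub w m) rs m x) (total T B w rs x m)

/-- The number of bits of `v` at the positions in `T`. -/
def weight (v : ℕ) : BinaryTree ℕ → ℕ
  | .nil => 0
  | .node j l r => weight v l + weight v r + (v.testBit j).toNat

theorem length_lanes (rs : List ℕ) (k : ℕ) : (lanes rs k).length = num rs k := by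
  fun_induction lanes rs k <;> simp_all [num]

theorem bitOf_eq (m j : ℕ) : bitOf m j = m.testBit j := by
  change Nat.beq ((m >>> j) &&& 1) 1 = ((1 &&& (m >>> j)) != 0)
  rw [Nat.and_comm, Nat.one_and_eq_mod_two]
  rcases Nat.mod_two_eq_zero_or_one (m >>> j) with h | h <;> rw [h] <;> rfl

theorem testBit_ones (n i : ℕ) : (ones n).testBit i = decide (i < n) := by
  change ((1 <<< n) - 1).testBit i = _
  rw [Nat.shiftLeft_eq, one_mul, Nat.testBit_two_pow_sub_one]

theorem testBit_col (j : ℕ) (rs : List ℕ) (k i : ℕ) :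
    (col j rs k).testBit i = ((lanes rs k)[i]?.map (Nat.testBit · j)).getD false := by
  fun_induction col j rs k generalizing i with
  | case1 => rcases i with _ | i <;> simp [lanes]
  | case2 => simp [lanes]
  | case3 r rs k ih1 ih2 =>
    change (_ ||| (_ <<< _) : ℕ).testBit i = _
    rw [Nat.testBit_or, Nat.testBit_shiftLeft, ih1, lanes, bitOf_eq]
    rcases lt_or_ge i (num rs (k + 1)) with h | h
    · rw [List.getElem?_append_left (by rwa [length_lanes])]
      simp [not_le.mpr h]
    · have e : (lanes rs (k + 1))[i]? = none := by
        rw [List.getElem?_eq_none_iff, length_lanes]; exact h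
      rw [List.getElem?_append_right (by rwa [length_lanes]), e, length_lanes, List.getElem?_map]
      rcases lt_or_ge (i - num rs (k + 1)) (num rs k) with h' | h'
      · have h2 := ih2 (i - num rs (k + 1))
        rw [List.getElem?_eq_getElem (by rwa [length_lanes])] at h2 ⊢
        cases hr : r.testBit j <;> simp [h, h2, testBit_ones, h', hr]
      · have e' : (lanes rs k)[i - num rs (k + 1)]? = none := by
          rw [List.getElem?_eq_none_iff, length_lanes]; exact h'
        have h2 := ih2 (i - num rs (k + 1))
        rw [e'] at h2 ⊢
        cases r.testBit j <;> simp [h2, testBit_ones, h']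

/-- The number in lane `i` of a bit-sliced vector. -/
def value (i : ℕ) : List ℕ → ℕ
  | [] => 0
  | a :: as => (a.testBit i).toNat + 2 * value i as

theorem value_addCarry (i : ℕ) (as : List ℕ) (c : ℕ) :
    value i (addCarry as c) = value i as + (c.testBit i).toNat := by
  induction as generalizing c with
  | nil => simp [addCarry, value]
  | cons a as ih =>
    rw [addCarry, value, ih, value]
    change ((a ^^^ c).testBit i).toNat + 2 * (_ + ((a &&& c).testBit i).toNat) = _
    rw [Nat.testBit_xor, Nat.testBit_and]
    cases a.testBit i <;> cases c.testBit i <;> simp <;> omega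

theorem value_addWithCarry (i : ℕ) (as bs : List ℕ) (c : ℕ) :
    value i (addWithCarry as bs c) = value i as + value i bs + (c.testBit i).toNat := by
  induction as generalizing bs c with
  | nil => simp [addWithCarry, value, value_addCarry]
  | cons a as ih =>
    rcases bs with _ | ⟨b, bs⟩
    · simp [addWithCarry, value, value_addCarry]
    · simp only [addWithCarry, value, ih]
      change (((a ^^^ b) ^^^ c).testBit i).toNat +
        2 * (_ + (((a &&& b) ||| ((a ^^^ b) &&& c) : ℕ).testBit i).toNat) = _
      simp only [Nat.testBit_xor, Nat.testBit_and, Nat.testBit_or]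
      cases a.testBit i <;> cases b.testBit i <;> cases c.testBit i <;> simp <;> omega

theorem testBit_eqMask (o i : ℕ) (bs : List ℕ) (t m : ℕ)
    (h : m.testBit i = true → o.testBit i = true) :
    (eqMask o bs t m).testBit i = (m.testBit i && decide (value i bs = t)) := by
  induction bs generalizing t m with
  | nil =>
    rcases t with _ | t
    · simp [eqMask, value]
    · have : Nat.beq (t + 1) 0 = false := rfl
      simp [eqMask, value, this]
  | cons b bs ih =>
    have e : (Nat.land m (bif Nat.beq (Nat.mod t 2) 1 then b else Nat.xor b o)).testBit i =
        (m.testBit i && (b.testBit i == decide (t % 2 = 1))) := by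
      change (m &&& (bif Nat.beq (t % 2) 1 then b else b ^^^ o)).testBit i = _
      rw [Nat.testBit_and]
      rcases Nat.mod_two_eq_zero_or_one t with ht | ht
      · have : Nat.beq 0 1 = false := rfl
        cases hm : m.testBit i <;> simp_all
      · simp [ht]
    rw [eqMask, ih, e, value]
    · have hd : Nat.div t 2 = t / 2 := rfl
      rw [hd]
      cases m.testBit i
      · simp
      · rw [Bool.true_and, Bool.true_and, Bool.eq_iff_iff]
        cases b.testBit i <;> simp <;> omega
    · rw [e]
      simp only [Bool.and_eq_true]
      exact fun h' => h h'.1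

theorem popCount_eq (n m : ℕ) :
    popCount n m = ((List.range (2 ^ n)).countP (m.testBit ·)) := by
  induction n generalizing m with
  | zero =>
    change m % 2 = _
    rcases Nat.mod_two_eq_zero_or_one m with h | h <;> simp [h, Nat.testBit_zero]
  | succ n ih =>
    rw [popCount]
    rcases eq_or_ne m 0 with rfl | hm
    · simp
    · have : Nat.beq m 0 = false := by
        rw [Bool.eq_false_iff]; intro h; exact hm (Nat.eq_of_beq_eq_true h)
      rw [this, cond_false, ih, ih, pow_succ, mul_two, List.range_add, List.countP_append,
        List.countP_map]
      change (_ + _ : ℕ) = _ + _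
      have hs : Nat.shiftLeft 1 n = 2 ^ n := by
        change 1 <<< n = _; rw [Nat.shiftLeft_eq, one_mul]
      congr 1
      · apply List.countP_congr
        intro i hi
        rw [List.mem_range] at hi
        change (m % (1 <<< (1 <<< n))).testBit i = true ↔ _
        rw [Nat.shiftLeft_eq, Nat.shiftLeft_eq, one_mul, one_mul, Nat.testBit_mod_two_pow]
        simp [hi]
      · apply List.countP_congr
        intro i _
        rw [hs]
        change (m >>> 2 ^ n).testBit i = true ↔ _
        simp [Nat.testBit_shiftRight]

theorem value_bits (f : ℕ → ℕ) (v i : ℕ) (T : BinaryTree ℕ)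
    (h : ∀ j, (f j).testBit i = v.testBit j) : value i (bits f T) = weight v T := by
  induction T with
  | nil => rfl
  | node j l r hl hr => rw [bits, value_addWithCarry, hl, hr, h, weight]

theorem countP_range_getElem? (l : List ℕ) (p : ℕ → Bool) (N : ℕ) (h : l.length ≤ N) :
    (List.range N).countP (fun i => (l[i]?.map p).getD false) = l.countP p := by
  obtain ⟨d, rfl⟩ := Nat.exists_eq_add_of_le h
  rw [List.range_add, List.countP_append, List.countP_map]
  have h0 : (List.range d).countP ((fun i => (l[i]?.map p).getD false) ∘ (l.length + ·)) = 0 := by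
    rw [List.countP_eq_zero]; intro i _; simp
  rw [h0, add_zero]
  induction l with
  | nil => rfl
  | cons a l ih =>
    simp_all [List.range_succ_eq_map, List.countP_cons, List.countP_map, Function.comp_def]

theorem batch_eq (T : BinaryTree ℕ) (rs : List ℕ) (k x t : ℕ) (h : num rs k ≤ 2 ^ 20) :
    batch T rs k x t = (lanes rs k).countP (fun v => weight (v ^^^ x) T = t) := by
  rw [← countP_range_getElem? _ _ (2 ^ 20) (by rwa [length_lanes])]
  refine (popCount_eq _ _).trans ?_
  congr 1
  funext i
  rw [testBit_eqMask _ _ _ _ _ id, testBit_ones]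
  rcases lt_or_ge i (num rs k) with hi | hi
  · have hi' : i < (lanes rs k).length := by rwa [length_lanes]
    rw [value_bits _ ((lanes rs k)[i] ^^^ x) i]
    · simp [hi, List.getElem?_eq_getElem hi']
    · intro j
      rw [bitOf_eq]
      have hc := testBit_col j rs k i
      rw [List.getElem?_eq_getElem hi'] at hc
      cases hr : x.testBit j <;> simp [hc, hr, testBit_ones, hi]
  · have e : (lanes rs k)[i]? = none := by
      rw [List.getElem?_eq_none_iff, length_lanes]; exact hi
    simp [e, not_lt.mpr hi]

theorem count_eq (T : BinaryTree ℕ) (B t : ℕ) (hB : B ≤ 2 ^ 20) (rs : List ℕ) (k x : ℕ) :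
    count T B t rs k x = (lanes rs k).countP (fun v => weight (v ^^^ x) T = t) := by
  fun_induction count T B t rs k x with
  | case1 rs x => exact batch_eq _ _ _ _ _ (by simp [num])
  | case2 k x => exact batch_eq _ _ _ _ _ (by simp [num])
  | case3 r rs k x h => exact batch_eq _ _ _ _ _ ((Nat.le_of_ble_eq_true h).trans hB)
  | case4 r rs k x h ih1 ih2 =>
    rw [ih1, ih2, lanes, List.countP_append, List.countP_map]
    change (_ + _ : ℕ) = _ + _
    congr 2
    funext v
    change _ = decide (weight ((v ^^^ r) ^^^ x) T = t)
    rw [Nat.xor_assoc, Nat.xor_comm r x]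
    rfl

end BitSlice

/-! ### Self-dual codes and the MacWilliams identity -/

namespace BinaryCode

open Polynomial

theorem val_eq_ite (a : ZMod 2) : a.val = if a ≠ 0 then 1 else 0 := by
  revert a; decide

theorem wt_eq_sum {m : ℕ} (x : Fin m → ZMod 2) : wt x = ∑ i, (x i).val := by
  simp only [wt, Finset.card_filter, val_eq_ite]

theorem natCast_wt {m : ℕ} (x : Fin m → ZMod 2) : (wt x : ZMod 2) = ∑ i, x i := by
  simp [wt_eq_sum]

theorem wt_append {m n : ℕ} (x : Fin m → ZMod 2) (y : Fin n → ZMod 2) :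
    wt (Fin.append x y) = wt x + wt y := by
  simp [wt_eq_sum, Fin.sum_univ_add]

theorem wt_add {m : ℕ} (x y : Fin m → ZMod 2) : wt (x + y) + 2 * wt (x * y) = wt x + wt y := by
  simp only [wt_eq_sum, Finset.mul_sum, ← Finset.sum_add_distrib, Pi.add_apply, Pi.mul_apply]
  refine Finset.sum_congr rfl fun i _ => ?_
  generalize x i = a
  generalize y i = b
  revert a b
  decide

theorem wt_add_one {m : ℕ} (x : Fin m → ZMod 2) : wt (x + 1) + wt x = m := by
  have h (a : ZMod 2) : (a + 1).val + a.val = 1 := by revert a; decide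
  simp [wt_eq_sum, ← Finset.sum_add_distrib, h]

theorem wt_le {m : ℕ} (x : Fin m → ZMod 2) : wt x ≤ m :=
  (Finset.card_filter_le _ _).trans (by simp)

theorem wt_eq_zero {m : ℕ} {x : Fin m → ZMod 2} : wt x = 0 ↔ x = 0 := by
  simp [wt_eq_sum, funext_iff]

/-- The nontrivial additive character of `ZMod 2`. -/
def sign : AddChar (ZMod 2) ℤ where
  toFun a := (-1) ^ a.val
  map_zero_eq_one' := by simp
  map_add_eq_mul' := by decide

theorem sign_sum {ι : Type*} (s : Finset ι) (f : ι → ZMod 2) :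
    sign (∑ i ∈ s, f i) = ∏ i ∈ s, sign (f i) := by
  classical
  induction s using Finset.induction_on with
  | empty => simp
  | insert a s ha ih =>
    rw [Finset.sum_insert ha, Finset.prod_insert ha, AddChar.map_add_eq_mul, ih]

/-- The Krawtchouk number, a coefficient of `(1 + X) ^ p * (1 - X) ^ q`. -/
def krawtchouk (p q k : ℕ) : ℤ :=
  ∑ i ∈ Finset.range (k + 1), (-1) ^ i * (q.choose i * p.choose (k - i) : ℕ)

theorem coeff_one_sub_X_pow (q i : ℕ) :
    ((1 - X : ℤ[X]) ^ q).coeff i = (-1) ^ i * (q.choose i : ℤ) := by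
  have h : (1 - X : ℤ[X]) ^ q = ((1 + X) ^ q).comp (C (-1) * X) := by simp [sub_eq_add_neg]
  rw [h, comp_C_mul_X_coeff, coeff_one_add_X_pow, mul_comm]

theorem coeff_krawtchouk (p q k : ℕ) :
    ((1 + X : ℤ[X]) ^ p * (1 - X) ^ q).coeff k = krawtchouk p q k := by
  rw [mul_comm, coeff_mul, Finset.Nat.sum_antidiagonal_eq_sum_range_succ_mk, krawtchouk]
  refine Finset.sum_congr rfl fun i _ => ?_
  rw [coeff_one_sub_X_pow, coeff_one_add_X_pow]
  push_cast
  ring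

theorem sum_sign_mul_X_pow {m : ℕ} (c : Fin m → ZMod 2) :
    ∑ u : Fin m → ZMod 2, C (sign (∑ i, c i * u i)) * X ^ wt u =
      (1 + X : ℤ[X]) ^ (m - wt c) * (1 - X) ^ wt c := by
  have h (a : ZMod 2) : ∑ b : ZMod 2, C (sign (a * b)) * X ^ b.val =
      if a ≠ 0 then (1 - X : ℤ[X]) else 1 + X := by
    have h2 (f : ZMod 2 → ℤ[X]) : ∑ b, f b = f 0 + f 1 := Fin.sum_univ_two f
    have h1 : (1 : ZMod 2).val = 1 := rfl
    have hs : sign 1 = -1 := rfl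
    have ha : a = 0 ∨ a = 1 := by revert a; decide
    rcases ha with rfl | rfl <;> simp [h2, h1, hs, sub_eq_add_neg]
  have h' (u : Fin m → ZMod 2) : C (sign (∑ i, c i * u i)) * (X : ℤ[X]) ^ wt u =
      ∏ i, C (sign (c i * u i)) * X ^ (u i).val := by
    rw [sign_sum, map_prod, wt_eq_sum, Finset.prod_mul_distrib,
      Finset.prod_pow_eq_pow_sum]
  rw [Finset.sum_congr rfl fun u _ => h' u]
  refine (Fintype.prod_sum fun i b => C (sign (c i * b)) * (X : ℤ[X]) ^ b.val).symm.trans ?_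
  simp only [h, Finset.prod_ite, Finset.prod_const]
  rw [mul_comm, ← wt]
  congr 2
  have := Finset.card_filter_add_card_filter_not (s := Finset.univ) (fun i => c i ≠ 0)
  rw [Finset.card_univ, Fintype.card_fin, ← wt] at this
  omega

theorem sum_sign_of_wt {m : ℕ} (c : Fin m → ZMod 2) (k : ℕ) :
    ∑ u : Fin m → ZMod 2 with wt u = k, sign (∑ i, c i * u i) =
      krawtchouk (m - wt c) (wt c) k := by
  rw [← coeff_krawtchouk, ← sum_sign_mul_X_pow, finsetSum_coeff, Finset.sum_filter]
  refine Finset.sum_congr rfl fun u _ => ?_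
  simp [coeff_X_pow, eq_comm]

/-- The defining property of a self-dual code. -/
def IsSelfDual {m : ℕ} (C : Submodule (ZMod 2) (Fin m → ZMod 2)) : Prop :=
  ∀ x, x ∈ C ↔ ∀ y ∈ C, ∑ i, x i * y i = 0

variable {m : ℕ} {C : Submodule (ZMod 2) (Fin m → ZMod 2)}

theorem IsSelfDual.even_wt (hC : IsSelfDual C) {c : Fin m → ZMod 2} (hc : c ∈ C) : Even (wt c) := by
  have h (a : ZMod 2) : a * a = a := by revert a; decide
  have := (hC c).1 hc c hc
  simp only [h, ← natCast_wt] at this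
  exact (ZMod.natCast_eq_zero_iff_even).1 this

theorem IsSelfDual.one_mem (hC : IsSelfDual C) : (1 : Fin m → ZMod 2) ∈ C := by
  refine (hC 1).2 fun y hy => ?_
  simpa [natCast_wt] using (ZMod.natCast_eq_zero_iff_even).2 (hC.even_wt hy)

open Classical in
theorem IsSelfDual.sum_sign (hC : IsSelfDual C) (v : Fin m → ZMod 2) :
    ∑ c : C, sign (∑ i, c.1 i * v i) = if v ∈ C then (Nat.card C : ℤ) else 0 := by
  split_ifs with hv
  · have h (c : C) : ∑ i, c.1 i * v i = 0 := (hC c.1).1 c.2 v hv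
    simp [h]
  · obtain ⟨y, hy, h⟩ : ∃ y ∈ C, ∑ i, v i * y i ≠ 0 := by
      by_contra! h
      exact hv ((hC v).2 h)
    have h1 : ∑ i, y i * v i = 1 := by
      have (a : ZMod 2) : a ≠ 0 → a = 1 := by revert a; decide
      simp_rw [mul_comm (y _)]
      exact this _ h
    have := Equiv.sum_comp (Equiv.addRight (⟨y, hy⟩ : C)) fun c : C => sign (∑ i, c.1 i * v i)
    simp only [Equiv.coe_addRight, Submodule.coe_add, Pi.add_apply, add_mul,
      Finset.sum_add_distrib, h1, AddChar.map_add_eq_mul, ← Finset.sum_mul] at this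
    have h2 : sign 1 = -1 := rfl
    rw [h2] at this
    linarith

/-- The number of words of weight `k` in the coset of `C` containing `t`. -/
noncomputable def cosetCount (C : Submodule (ZMod 2) (Fin m → ZMod 2)) (t : Fin m → ZMod 2)
    (k : ℕ) : ℕ :=
  {u | u + t ∈ C ∧ wt u = k}.ncard

open Classical in
theorem IsSelfDual.macWilliams (hC : IsSelfDual C) (t : Fin m → ZMod 2) (k : ℕ) :
    ∑ c : C, sign (∑ i, c.1 i * t i) * krawtchouk (m - wt c.1) (wt c.1) k =
      Nat.card C * cosetCount C t k := by
  simp_rw [← sum_sign_of_wt, Finset.mul_sum, ← AddChar.map_add_eq_mul,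
    ← Finset.sum_add_distrib, ← mul_add]
  rw [Finset.sum_comm]
  have h (u : Fin m → ZMod 2) := hC.sum_sign (t + u)
  simp only [Pi.add_apply] at h
  simp_rw [h, ← Finset.sum_filter, Finset.filter_filter, Finset.sum_const, cosetCount]
  rw [Set.ncard_eq_toFinset_card', nsmul_eq_mul, mul_comm]
  congr 3
  ext u
  simp [add_comm, and_comm]

open Classical in
theorem sum_eq_sum_cosetCount (g : ℕ → ℤ) :
    ∑ c : C, g (wt c.1) = ∑ j ∈ Finset.range (m + 1), cosetCount C 0 j * g j := by
  rw [← Finset.sum_fiberwise_of_maps_to (s := Finset.univ) (t := Finset.range (m + 1))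
    (g := fun c : C => wt c.1) fun c _ => Finset.mem_range.2 (Nat.lt_succ_of_le (wt_le c.1))]
  refine Finset.sum_congr rfl fun j _ => ?_
  rw [Finset.sum_congr rfl (g := fun _ => g j) fun c hc => by rw [(Finset.mem_filter.1 hc).2],
    Finset.sum_const, nsmul_eq_mul, cosetCount, ← Set.ncard_coe_finset,
    ← Set.ncard_image_of_injective _ Subtype.val_injective]
  congr 3
  ext u
  simp [and_comm]

theorem IsSelfDual.cosetCount_sub (hC : IsSelfDual C) {j : ℕ} (hj : j ≤ m) :
    cosetCount C 0 (m - j) = cosetCount C 0 j := by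
  rw [cosetCount, cosetCount, ← Set.ncard_image_of_injective _ (add_left_injective 1)]
  congr 1
  ext u
  simp only [Set.mem_image, Set.mem_ofPred_eq, add_zero]
  constructor
  · rintro ⟨v, ⟨hv, hw⟩, rfl⟩
    have := wt_add_one v
    exact ⟨C.add_mem hv hC.one_mem, by omega⟩
  · rintro ⟨hu, hw⟩
    have := wt_add_one u
    refine ⟨u + 1, ⟨C.add_mem hu hC.one_mem, by omega⟩, ?_⟩
    have h2 : (1 : Fin m → ZMod 2) + 1 = 0 := by ext; exact CharTwo.add_self_eq_zero 1
    simp only [add_assoc, h2, add_zero]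

theorem IsSelfDual.cosetCount_odd (hC : IsSelfDual C) {j : ℕ} (hj : ¬ Even j) :
    cosetCount C 0 j = 0 := by
  rw [cosetCount, Set.ncard_eq_zero, Set.eq_empty_iff_forall_notMem]
  rintro u ⟨hu, rfl⟩
  rw [add_zero] at hu
  exact hj (hC.even_wt hu)

theorem cosetCount_zero_zero : cosetCount C 0 0 = 1 := by
  have h : {u : Fin m → ZMod 2 | u + 0 ∈ C ∧ wt u = 0} = {0} := by
    ext u
    simp only [Set.mem_ofPred_eq, Set.mem_singleton_iff, wt_eq_zero, add_zero]
    exact ⟨fun h => h.2, fun h => ⟨h ▸ C.zero_mem, h⟩⟩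
  rw [cosetCount, h, Set.ncard_singleton]

theorem IsSelfDual.sum_krawtchouk (hC : IsSelfDual C) (k : ℕ) :
    ∑ j ∈ Finset.range (m + 1), cosetCount C 0 j * krawtchouk (m - j) j k =
      Nat.card C * cosetCount C 0 k := by
  rw [← hC.macWilliams, ← sum_eq_sum_cosetCount fun j => krawtchouk (m - j) j k]
  simp

theorem IsSelfDual.sum_krawtchouk_shadow (hC : IsSelfDual C) {t : Fin m → ZMod 2}
    (ht : ∀ c ∈ C, 4 ∣ wt c + 2 * (∑ i, c i * t i).val) (k : ℕ) :
    ∑ j ∈ Finset.range (m + 1), cosetCount C 0 j * ((-1) ^ (j / 2) * krawtchouk (m - j) j k) =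
      Nat.card C * cosetCount C t k := by
  rw [← hC.macWilliams,
    ← sum_eq_sum_cosetCount fun j => (-1) ^ (j / 2) * krawtchouk (m - j) j k]
  refine Finset.sum_congr rfl fun c _ => ?_
  congr 1
  obtain ⟨q, hq⟩ := ht c.1 c.2
  have h : ∀ a : ZMod 2, a.val = 0 ∨ a.val = 1 := by decide
  change _ = (-1) ^ (∑ i, c.1 i * t i).val
  rcases h (∑ i, c.1 i * t i) with h | h <;> rw [h] at hq ⊢
  · rw [show wt c.1 / 2 = 2 * q by omega, pow_mul]
    simp
  · rw [show wt c.1 / 2 = 2 * (q - 1) + 1 by omega, pow_succ, pow_mul]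
    simp

end BinaryCode

/-! ### Systematic codes given by bit masks -/

namespace BinaryCode

open BitSlice

open scoped Matrix

/-- The binary vector whose entries are the lowest bits of `v`. -/
def vec {n : ℕ} (v : ℕ) : Fin n → ZMod 2 := fun j => if v.testBit j then 1 else 0

@[simp] theorem vec_zero {n : ℕ} : (vec 0 : Fin n → ZMod 2) = 0 := by
  ext; simp [vec]

theorem vec_xor {n : ℕ} (a b : ℕ) : (vec (a ^^^ b) : Fin n → ZMod 2) = vec a + vec b := by
  ext j
  simp only [vec, Nat.testBit_xor, Pi.add_apply]
  cases a.testBit j <;> cases b.testBit j <;> decide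

theorem add_self {ι : Type*} (v : ι → ZMod 2) : v + v = 0 := by
  ext i
  exact CharTwo.add_self_eq_zero (v i)

theorem wt_vec {n : ℕ} (v : ℕ) :
    wt (vec v : Fin n → ZMod 2) = ∑ j ∈ Finset.range n, (v.testBit j).toNat := by
  rw [wt_eq_sum, ← Fin.sum_univ_eq_sum_range]
  refine Finset.sum_congr rfl fun j _ => ?_
  rw [vec]
  cases v.testBit j <;> rfl

theorem wt_cons {n : ℕ} (a : ZMod 2) (x : Fin n → ZMod 2) :
    wt (Fin.cons a x : Fin (n + 1) → ZMod 2) = a.val + wt x := by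
  simp [wt_eq_sum, Fin.sum_univ_succ]

theorem countP_lanes {n p : ℕ} (r : Fin n → ℕ) (k : ℕ) (P : (Fin p → ZMod 2) → Prop)
    [DecidablePred P] :
    (lanes (List.ofFn r) k).countP (fun v => P (vec v)) =
      (Finset.univ.filter fun x : Fin n → ZMod 2 => wt x = k ∧ P (∑ i, x i • vec (r i))).card := by
  induction n generalizing k P with
  | zero =>
    have h (x : Fin 0 → ZMod 2) : wt x = 0 := by simp [wt]
    rcases k with _ | k
    · by_cases hP : P 0 <;> simp [lanes, h, hP, Finset.filter_true_of_mem]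
    · simp [lanes, h]
  | succ n ih =>
    rcases k with _ | k
    · have h (x : Fin (n + 1) → ZMod 2) :
          (wt x = 0 ∧ P (∑ i, x i • vec (r i))) ↔ x = 0 ∧ P 0 := by
        rw [wt_eq_zero]
        refine and_congr_right ?_
        rintro rfl
        simp
      by_cases hP : P 0 <;> simp [lanes, h, hP, Finset.filter_eq']
    · have h2 (f : ZMod 2 → ℕ) : ∑ b, f b = f 0 + f 1 := Fin.sum_univ_two f
      have hv (x : Fin n → ZMod 2) : 1 + wt x = k + 1 ↔ wt x = k := by omega
      have h1 : (1 : ZMod 2).val = 1 := rfl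
      rw [List.ofFn_succ, lanes, List.countP_append, List.countP_map, ih, Finset.card_filter,
        Finset.card_filter, ← Equiv.sum_comp (Fin.consEquiv fun _ => ZMod 2),
        Fintype.sum_prod_type, h2]
      have h3 := ih (fun i => r i.succ) k (fun w => P (w + vec (r 0)))
      rw [Finset.card_filter] at h3
      congr 1
      · simp [Fin.consEquiv, wt_cons, Fin.sum_univ_succ]
      · simp only [Fin.consEquiv, Equiv.coe_fn_mk, wt_cons, Fin.sum_univ_succ, Fin.cons_zero,
          Fin.cons_succ, one_smul, h1, hv, add_comm (vec (r 0))]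
        rw [← h3]
        refine List.countP_congr fun v _ => ?_
        rw [← vec_xor]
        rfl

/-- The bitwise sum of the entries of a list selected by the bits of `m`. -/
def xorSum : List ℕ → ℕ → ℕ
  | [], _ => 0
  | r :: rs, m => Nat.xor (bif m.testBit 0 then r else 0) (xorSum rs (m / 2))

theorem vec_xorSum {n p : ℕ} (r : Fin n → ℕ) (m : ℕ) :
    (vec (xorSum (List.ofFn r) m) : Fin p → ZMod 2) =
      ∑ i, (vec m : Fin n → ZMod 2) i • vec (r i) := by
  induction n generalizing m with
  | zero => simp [xorSum]
  | succ n ih =>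
    rw [List.ofFn_succ, xorSum, Fin.sum_univ_succ]
    refine (vec_xor _ _).trans ?_
    rw [ih]
    congr 1
    · simp only [vec, Fin.val_zero]
      rcases Bool.eq_false_or_eq_true (m.testBit 0) with h | h <;> simp [h]
    · simp [vec, Nat.testBit_succ]

variable {n : ℕ}

/-- The matrix whose rows are given by bit masks. -/
def maskMatrix (r : Fin n → ℕ) : Matrix (Fin n) (Fin n) (ZMod 2) := fun i => vec (r i)

theorem vec_vecMul_maskMatrix (r : Fin n → ℕ) (m : ℕ) :
    vec m ᵥ* maskMatrix r = vec (xorSum (List.ofFn r) m) := by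
  rw [vec_xorSum, Matrix.vecMul_eq_sum]
  rfl

/-- The number of vectors `x` of weight `k` for which `x A + o` has weight `t`. -/
def pairCount (A : Matrix (Fin n) (Fin n) (ZMod 2)) (o : Fin n → ZMod 2) (k t : ℕ) : ℕ :=
  (Finset.univ.filter fun x : Fin n → ZMod 2 => wt x = k ∧ wt (x ᵥ* A + o) = t).card

theorem count_eq_pairCount (r : Fin n → ℕ) (T : BinaryTree ℕ)
    (hT : ∀ v, weight v T = wt (vec v : Fin n → ZMod 2)) (B : ℕ) (hB : B ≤ 2 ^ 20) (t k x : ℕ) :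
    count T B t (List.ofFn r) k x = pairCount (maskMatrix r) (vec x) k t := by
  rw [count_eq T B t hB, pairCount]
  simp_rw [Matrix.vecMul_eq_sum, hT, vec_xor]
  exact countP_lanes r k fun w => wt (w + vec x) = t

theorem total_eq_sum (r : Fin n → ℕ) (T : BinaryTree ℕ)
    (hT : ∀ v, weight v T = wt (vec v : Fin n → ZMod 2)) (B : ℕ) (hB : B ≤ 2 ^ 20) (w x m : ℕ) :
    total T B w (List.ofFn r) x m =
      ∑ k ∈ Finset.range m, pairCount (maskMatrix r) (vec x) k (w - k) := by
  induction m with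
  | zero => rfl
  | succ m ih =>
    rw [Finset.sum_range_succ, ← ih, ← count_eq_pairCount r T hT B hB]
    exact Nat.add_comm _ _

theorem pairCount_transpose {A : Matrix (Fin n) (Fin n) (ZMod 2)} (hA : A * Aᵀ = 1)
    (o : Fin n → ZMod 2) (k t : ℕ) : pairCount Aᵀ (o ᵥ* Aᵀ) k t = pairCount A o t k := by
  have h1 (x : Fin n → ZMod 2) : (x ᵥ* A + o) ᵥ* Aᵀ + o ᵥ* Aᵀ = x := by
    rw [Matrix.add_vecMul, Matrix.vecMul_vecMul, hA, Matrix.vecMul_one, add_assoc, add_self,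
      add_zero]
  have h3 (y : Fin n → ZMod 2) : (y ᵥ* Aᵀ + o ᵥ* Aᵀ) ᵥ* A + o = y := by
    rw [Matrix.add_vecMul, Matrix.vecMul_vecMul, Matrix.vecMul_vecMul, mul_eq_one_comm.1 hA,
      Matrix.vecMul_one, Matrix.vecMul_one, add_assoc, add_self, add_zero]
  refine Finset.card_nbij' (fun y => y ᵥ* Aᵀ + o ᵥ* Aᵀ) (fun x => x ᵥ* A + o) ?_ ?_ ?_ ?_
  · intro y hy
    simp only [Finset.coe_filter, Finset.mem_univ, true_and, Set.mem_ofPred_eq] at hy ⊢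
    rw [h3]
    exact hy.symm
  · intro x hx
    simp only [Finset.coe_filter, Finset.mem_univ, true_and, Set.mem_ofPred_eq] at hx ⊢
    rw [h1]
    exact hx.symm
  · exact fun y _ => h3 y
  · exact fun x _ => h1 x

/-- The encoder `x ↦ (x, x A)`. -/
def encode (A : Matrix (Fin n) (Fin n) (ZMod 2)) :
    (Fin n → ZMod 2) →ₗ[ZMod 2] (Fin (n + n) → ZMod 2) where
  toFun x := Fin.append x (x ᵥ* A)
  map_add' x y := by
    ext i
    refine Fin.addCases (fun i => ?_) (fun i => ?_) i <;>
      simp [Matrix.add_vecMul, -Fin.natAdd_eq_addNat]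
  map_smul' a x := by
    ext i
    refine Fin.addCases (fun i => ?_) (fun i => ?_) i <;>
      simp [Matrix.smul_vecMul, -Fin.natAdd_eq_addNat]

/-- The code generated by the rows of `(1 | A)`. -/
def code (A : Matrix (Fin n) (Fin n) (ZMod 2)) : Submodule (ZMod 2) (Fin (n + n) → ZMod 2) :=
  LinearMap.range (encode A)

theorem encode_injective (A : Matrix (Fin n) (Fin n) (ZMod 2)) :
    Function.Injective (encode A) :=
  fun x y h => funext fun i => by
    simpa [encode] using congrFun h (Fin.castAdd n i)

theorem finrank_code (A : Matrix (Fin n) (Fin n) (ZMod 2)) :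
    Module.finrank (ZMod 2) (code A) = n := by
  rw [code, LinearMap.finrank_range_of_inj (encode_injective A), Module.finrank_fin_fun]

theorem natCard_code (A : Matrix (Fin n) (Fin n) (ZMod 2)) : Nat.card (code A) = 2 ^ n := by
  rw [Module.natCard_eq_pow_finrank (K := ZMod 2), finrank_code, Nat.card_zmod]

theorem sum_encode_mul (A : Matrix (Fin n) (Fin n) (ZMod 2)) (x : Fin n → ZMod 2)
    (y : Fin (n + n) → ZMod 2) :
    ∑ i, encode A x i * y i =
      x ⬝ᵥ ((fun i => y (Fin.castAdd n i)) + A *ᵥ fun i => y (Fin.natAdd n i)) := by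
  rw [dotProduct_add, Matrix.dotProduct_mulVec, Fin.sum_univ_add]
  simp [encode, dotProduct, -Fin.natAdd_eq_addNat]

theorem isSelfDual_code {A : Matrix (Fin n) (Fin n) (ZMod 2)} (hA : A * Aᵀ = 1) :
    IsSelfDual (code A) := by
  intro z
  have key : z ∈ code A ↔
      (fun i => z (Fin.castAdd n i)) + A *ᵥ (fun i => z (Fin.natAdd n i)) = 0 := by
    constructor
    · rintro ⟨x, rfl⟩
      have : A *ᵥ (x ᵥ* A) = x := by
        rw [← Matrix.mulVec_transpose, Matrix.mulVec_mulVec, hA, Matrix.one_mulVec]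
      have hl : (fun i => encode A x (Fin.castAdd n i)) = x := funext (Fin.append_left _ _)
      have hr : (fun i => encode A x (Fin.natAdd n i)) = x ᵥ* A := funext (Fin.append_right _ _)
      rw [hl, hr, this, add_self]
    · intro h
      have h' : (fun i => z (Fin.castAdd n i)) = A *ᵥ (fun i => z (Fin.natAdd n i)) := by
        rw [← add_zero (fun i => _), ← add_self (A *ᵥ _), ← add_assoc, h, zero_add]
      refine ⟨fun i => z (Fin.castAdd n i), ?_⟩
      have h'' : (fun i => z (Fin.castAdd n i)) ᵥ* A = fun i => z (Fin.natAdd n i) := by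
        rw [h', ← Matrix.vecMul_transpose, Matrix.vecMul_vecMul, mul_eq_one_comm.1 hA,
          Matrix.vecMul_one]
      ext i
      refine Fin.addCases (fun i => ?_) (fun i => ?_) i
      · simp [encode]
      · simpa [encode, -Fin.natAdd_eq_addNat] using congrFun h'' i
  rw [key]
  constructor
  · rintro h _ ⟨x, rfl⟩
    simp_rw [mul_comm (z _)]
    rw [sum_encode_mul, h, dotProduct_zero]
  · intro h
    refine dotProduct_eq_zero_iff.1 fun x => ?_
    rw [dotProduct_comm, ← sum_encode_mul]
    simp_rw [mul_comm _ (z _)]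
    exact h _ ⟨x, rfl⟩

theorem cosetCount_code_eq_sum (A : Matrix (Fin n) (Fin n) (ZMod 2)) (o : Fin n → ZMod 2) (w : ℕ) :
    cosetCount (code A) (Fin.append 0 o) w =
      ∑ k ∈ Finset.range (w + 1), pairCount A o k (w - k) := by
  have e (x : Fin n → ZMod 2) : encode A x + Fin.append 0 o = Fin.append x (x ᵥ* A + o) := by
    ext i
    refine Fin.addCases (fun i => ?_) (fun i => ?_) i <;>
      simp [encode, -Fin.natAdd_eq_addNat]
  have h : {u | u + Fin.append 0 o ∈ code A ∧ wt u = w} =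
      (fun x => encode A x + Fin.append 0 o) '' {x | wt x + wt (x ᵥ* A + o) = w} := by
    ext u
    constructor
    · rintro ⟨⟨x, hx⟩, hw⟩
      have hu : encode A x + Fin.append 0 o = u := by rw [hx, add_assoc, add_self, add_zero]
      refine ⟨x, ?_, hu⟩
      rw [Set.mem_ofPred_eq, ← hw, ← hu, e, wt_append]
    · rintro ⟨x, hx, rfl⟩
      refine ⟨⟨x, by rw [add_assoc, add_self, add_zero]⟩, ?_⟩
      simp only [e, wt_append]
      exact hx
  rw [cosetCount, h, Set.ncard_image_of_injective (f := fun x => encode A x + Fin.append 0 o) _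
    ((add_left_injective _).comp (encode_injective A)), Set.ncard_eq_toFinset_card',
    Finset.card_eq_sum_card_fiberwise (f := wt) (t := Finset.range (w + 1))]
  · refine Finset.sum_congr rfl fun k hk => ?_
    rw [pairCount]
    congr 1
    ext x
    have := Finset.mem_range.1 hk
    simp only [Set.toFinset_ofPred, Finset.mem_filter, Finset.mem_univ, true_and]
    omega
  · intro x hx
    simp only [Set.coe_toFinset, Set.mem_ofPred_eq, Finset.coe_range, Set.mem_Iio] at hx ⊢
    omega

theorem cosetCount_code {A : Matrix (Fin n) (Fin n) (ZMod 2)} (hA : A * Aᵀ = 1)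
    (o : Fin n → ZMod 2) {a b w : ℕ} (h : a + b = w + 1) :
    cosetCount (code A) (Fin.append 0 o) w =
      ∑ k ∈ Finset.range a, pairCount A o k (w - k) +
        ∑ k ∈ Finset.range b, pairCount Aᵀ (o ᵥ* Aᵀ) k (w - k) := by
  rw [cosetCount_code_eq_sum, ← h, Finset.sum_range_add, ← Finset.sum_range_reflect _ b]
  congr 1
  refine Finset.sum_congr rfl fun k hk => ?_
  have := Finset.mem_range.1 hk
  rw [pairCount_transpose hA]
  congr 1 <;> omega

/-- If the generators have weight congruent to twice their product with `t` modulo `4`, then so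
do all codewords. -/
theorem four_dvd_of_generators {A : Matrix (Fin n) (Fin n) (ZMod 2)} (hA : A * Aᵀ = 1)
    (t : Fin (n + n) → ZMod 2)
    (h : ∀ i, 4 ∣ wt (encode A (Pi.single i 1)) +
      2 * (∑ j, encode A (Pi.single i 1) j * t j).val)
    {c : Fin (n + n) → ZMod 2} (hc : c ∈ code A) : 4 ∣ wt c + 2 * (∑ j, c j * t j).val := by
  obtain ⟨x, rfl⟩ := hc
  rw [LinearMap.pi_apply_eq_sum_univ (encode A) x]
  refine (Finset.sum_induction (fun i => x i • encode A (fun j => if i = j then 1 else 0))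
    (fun c => c ∈ code A ∧ 4 ∣ wt c + 2 * (∑ j, c j * t j).val) ?_ ?_ ?_).2
  · rintro a b ⟨ha, ha'⟩ ⟨hb, hb'⟩
    refine ⟨add_mem ha hb, ?_⟩
    have h1 : 2 ∣ wt (a * b) := by
      rw [← ZMod.natCast_eq_zero_iff, natCast_wt]
      exact (isSelfDual_code hA a).1 ha b hb
    have h2 := wt_add a b
    have h3 (p q : ZMod 2) : (p + q).val = p.val + q.val ∨ (p + q).val + 2 = p.val + q.val := by
      revert p q; decide
    simp only [Pi.add_apply, add_mul, Finset.sum_add_distrib]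
    have := h3 (∑ j, a j * t j) (∑ j, b j * t j)
    omega
  · exact ⟨zero_mem _, by simp [wt]⟩
  · intro i _
    have hi : (fun j => if i = j then (1 : ZMod 2) else 0) = Pi.single i 1 := by
      ext j; simp [Pi.single_apply, eq_comm]
    rw [hi]
    have : x i = 0 ∨ x i = 1 := by generalize x i = a; revert a; decide
    rcases this with hx | hx <;> rw [hx]
    · rw [zero_smul]
      exact ⟨zero_mem _, by simp [wt]⟩
    · rw [one_smul]
      exact ⟨⟨_, rfl⟩, h i⟩

theorem four_dvd_of_masks {r : Fin n → ℕ} (hA : maskMatrix r * (maskMatrix r)ᵀ = 1) (s : ℕ)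
    (h : ∀ i, 4 ∣ 1 + ∑ j ∈ Finset.range n, ((r i).testBit j).toNat +
      2 * ((∑ j ∈ Finset.range n, ((r i).testBit j && s.testBit j).toNat) % 2))
    {c : Fin (n + n) → ZMod 2} (hc : c ∈ code (maskMatrix r)) :
    4 ∣ wt c + 2 * (∑ j, c j * (Fin.append 0 (vec s) : Fin (n + n) → ZMod 2) j).val := by
  refine four_dvd_of_generators hA _ (fun i => ?_) hc
  have h1 : encode (maskMatrix r) (Pi.single i 1) =
      Fin.append (Pi.single i 1 : Fin n → ZMod 2) (vec (r i)) :=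
    congrArg (Fin.append _) (Matrix.single_one_vecMul i (maskMatrix r))
  have h2 : wt (Pi.single i 1 : Fin n → ZMod 2) = 1 := by
    simp [wt, Pi.single_apply, Finset.filter_eq']
  have h3 : (∑ j, (vec (r i) : Fin n → ZMod 2) j * vec s j).val =
      (∑ j ∈ Finset.range n, ((r i).testBit j && s.testBit j).toNat) % 2 := by
    rw [← ZMod.val_natCast, Nat.cast_sum, ← Fin.sum_univ_eq_sum_range (fun j =>
      ((((r i).testBit j && s.testBit j).toNat : ℕ) : ZMod 2))]
    congr 1
    refine Finset.sum_congr rfl fun j _ => ?_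
    simp only [vec]
    cases (r i).testBit j <;> cases s.testBit j <;> rfl
  rw [h1, wt_append, h2, wt_vec, Fin.sum_univ_add]
  simp only [Fin.append_left, Fin.append_right, Pi.zero_apply, mul_zero, Finset.sum_const_zero,
    zero_add, h3]
  exact h i

end BinaryCode

/-! ### A self-dual code of length 94 -/

namespace Code94

open BitSlice BinaryCode

open scoped Matrix

/-- The rows of the generator matrix, without its identity part. -/
def rows : List ℕ :=
  [65501827061965, 44918206320229, 50901079909173, 66617787729514, 62866835475668,
   50188189492823, 40361113563985, 45537855039138, 49661782471355, 41413927606921,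
   57909637335789, 45450534688218, 49836423173195, 64488474257558, 58608208531756,
   58705443380647, 47042146777934, 46653198993763, 58122025898694, 59677808646771,
   48986877310182, 42763737929267, 55210016691097, 89251143689642, 102972689331371,
   100392266590550, 80690443529555, 84909721757017, 99450699336370, 93348286600548,
   94778403509559, 84003694946926, 78283218922275, 89724170971577, 73895229870962,
   98500149074203, 84474678562249, 77341251691629, 84313759205594, 77663090404939,
   90964428006249, 99546120698157, 82382735314341, 81525138187445, 83240332441237,
   79809943933653, 35184372088831]

/-- The columns of the generator matrix, without its identity part. -/
def cols : List ℕ :=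
  [140442434443111, 71252832139688, 138679697138743, 74743332036361, 132277986666868,
   87032977868174, 107703521188987, 136691928313745, 78200327882820, 124818467653614,
   101912824289466, 77908929127955, 125397500812097, 100758046450148, 80248549463215,
   121237959032376, 109112027048726, 133876057063755, 83836298597872, 114091988532358,
   123366318009962, 105405593504691, 133795385925460, 84542564870606, 112646228722939,
   126846248099472, 97857322658375, 85465822905320, 110833466937527, 129886650938888,
   92326270335863, 97081435709833, 87051958506612, 107631734308751, 136874769180792,
   78348971100054, 124516877736011, 103104949430256, 74976005707910, 131778743707243,
   88025614834609, 105163656994821, 71407744374636, 138919091059135, 73712171541529, 8388607,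
   70368735789056]

/-- A tree whose nodes are labelled by `0, …, 46`. -/
def tree : BinaryTree ℕ :=
  .node 46 (.node 30 (.node 14 (.node 6 (.node 2 (.node 0 .nil .nil) (.node 1 .nil .nil)) (.node
    5 (.node 3 .nil .nil) (.node 4 .nil .nil))) (.node 13 (.node 9 (.node 7 .nil .nil) (.node 8
    .nil .nil)) (.node 12 (.node 10 .nil .nil) (.node 11 .nil .nil)))) (.node 29 (.node 21
    (.node 17 (.node 15 .nil .nil) (.node 16 .nil .nil)) (.node 20 (.node 18 .nil .nil) (.node
    19 .nil .nil))) (.node 28 (.node 24 (.node 22 .nil .nil) (.node 23 .nil .nil)) (.node 27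
    (.node 25 .nil .nil) (.node 26 .nil .nil))))) (.node 45 (.node 37 (.node 33 (.node 31 .nil
    .nil) (.node 32 .nil .nil)) (.node 36 (.node 34 .nil .nil) (.node 35 .nil .nil))) (.node 44
    (.node 40 (.node 38 .nil .nil) (.node 39 .nil .nil)) (.node 43 (.node 41 .nil .nil) (.node
    42 .nil .nil))))

theorem weight_tree (v : ℕ) : weight v tree = wt (vec v : Fin 47 → ZMod 2) := by
  rw [wt_vec]
  simp only [weight, tree, Finset.sum_range_succ, Finset.sum_range_zero]
  omega

/-- The `i`-th row. -/
def row (i : Fin 47) : ℕ := rows.getD i 0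

/-- The `i`-th column. -/
def column (i : Fin 47) : ℕ := cols.getD i 0

theorem ofFn_row : List.ofFn row = rows := by decide +kernel

theorem ofFn_column : List.ofFn column = cols := by decide +kernel

theorem maskMatrix_column : maskMatrix column = (maskMatrix row)ᵀ := by
  have h : ∀ i j : Fin 47, (column i).testBit j = (row j).testBit i := by decide +kernel
  ext i j
  simp [maskMatrix, vec, h]

theorem mul_transpose : maskMatrix row * (maskMatrix row)ᵀ = 1 := by
  rw [mul_eq_one_comm, ← maskMatrix_column]
  have h : ∀ i : Fin 47, xorSum rows (column i) = 2 ^ i.val := by decide +kernel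
  ext i j
  have h1 : (maskMatrix column * maskMatrix row) i = vec (column i) ᵥ* maskMatrix row := rfl
  rw [h1, vec_vecMul_maskMatrix, ofFn_row, h, vec, Nat.testBit_two_pow, Matrix.one_apply]
  simp [Fin.ext_iff]

/-- A mask of a vector in the shadow of the code. -/
def shadowMask : ℕ := 35184367894528

theorem shadowMask_vecMul :
    (vec shadowMask : Fin 47 → ZMod 2) ᵥ* (maskMatrix row)ᵀ = vec 93910455651618 := by
  have h : xorSum cols shadowMask = 93910455651618 := by decide +kernel
  rw [← maskMatrix_column, vec_vecMul_maskMatrix, ofFn_column, h]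

theorem four_dvd {c : Fin (47 + 47) → ZMod 2} (hc : c ∈ code (maskMatrix row)) :
    4 ∣ wt c + 2 * (∑ j, c j * (Fin.append 0 (vec shadowMask) : Fin (47 + 47) → ZMod 2) j).val :=
  four_dvd_of_masks mul_transpose shadowMask (by decide +kernel) hc

theorem total_rows_2 : total tree 800000 2 rows 0 2 = 0 := by
  decide +kernel

theorem total_cols_2 : total tree 800000 2 cols 0 1 = 0 := by
  decide +kernel

theorem total_rows_4 : total tree 800000 4 rows 0 3 = 0 := by
  decide +kernel

theorem total_cols_4 : total tree 800000 4 cols 0 2 = 0 := by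
  decide +kernel

theorem total_rows_6 : total tree 800000 6 rows 0 4 = 0 := by
  decide +kernel

theorem total_cols_6 : total tree 800000 6 cols 0 3 = 0 := by
  decide +kernel

theorem total_rows_8 : total tree 800000 8 rows 0 5 = 0 := by
  decide +kernel

theorem total_cols_8 : total tree 800000 8 cols 0 4 = 0 := by
  decide +kernel

theorem total_rows_10 : total tree 800000 10 rows 0 6 = 0 := by
  decide +kernel

theorem total_cols_10 : total tree 800000 10 cols 0 5 = 0 := by
  decide +kernel

theorem total_rows_12 : total tree 800000 12 rows 0 7 = 0 := by
  decide +kernel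

theorem total_cols_12 : total tree 800000 12 cols 0 6 = 0 := by
  decide +kernel

theorem total_rows_14 : total tree 800000 14 rows 0 8 = 0 := by
  decide +kernel

theorem total_cols_14 : total tree 800000 14 cols 0 7 = 0 := by
  decide +kernel

theorem total_rows_shadow_3 : total tree 800000 3 rows shadowMask 2 = 0 := by
  decide +kernel

theorem total_cols_shadow_3 : total tree 800000 3 cols 93910455651618 2 = 0 := by
  decide +kernel

theorem total_rows_shadow_7 : total tree 800000 7 rows shadowMask 4 = 0 := by
  decide +kernel

theorem total_cols_shadow_7 : total tree 800000 7 cols 93910455651618 4 = 0 := by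
  decide +kernel

theorem total_rows_shadow_11 : total tree 800000 11 rows shadowMask 6 = 82 := by
  decide +kernel

theorem total_cols_shadow_11 : total tree 800000 11 cols 93910455651618 6 = 10 := by
  decide +kernel

theorem total_rows_shadow_15 : total tree 800000 15 rows shadowMask 8 = 1434 := by
  decide +kernel

theorem total_cols_shadow_15 : total tree 800000 15 cols 93910455651618 8 = 1556 := by
  decide +kernel

theorem cosetCount_eq (x y : ℕ)
    (h : (vec x : Fin 47 → ZMod 2) ᵥ* (maskMatrix row)ᵀ = vec y) {a b w c d : ℕ}
    (hr : total tree 800000 w rows x a = c) (hc : total tree 800000 w cols y b = d)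
    (hab : a + b = w + 1) :
    cosetCount (code (maskMatrix row)) (Fin.append 0 (vec x)) w = c + d := by
  have hB : 800000 ≤ 2 ^ 20 := by norm_num
  rw [cosetCount_code mul_transpose _ hab, h, ← maskMatrix_column,
    ← total_eq_sum row tree weight_tree 800000 hB, ← total_eq_sum column tree weight_tree 800000 hB,
    ofFn_row, ofFn_column, hr, hc]

theorem cosetCount_zero_eq_zero {a b w : ℕ} (hr : total tree 800000 w rows 0 a = 0)
    (hc : total tree 800000 w cols 0 b = 0) (hab : a + b = w + 1) :
    cosetCount (code (maskMatrix row)) 0 w = 0 := by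
  have h := cosetCount_eq 0 0 (by simp) hr hc hab
  have h0 : (Fin.append 0 (vec 0 : Fin 47 → ZMod 2) : Fin (47 + 47) → ZMod 2) = 0 := by
    ext i
    refine Fin.addCases (fun i => ?_) (fun i => ?_) i <;> simp [-Fin.natAdd_eq_addNat]
  rwa [h0] at h

/-- The code, as a set of words of length 94. -/
def code94 : Submodule (ZMod 2) (Fin 94 → ZMod 2) := code (maskMatrix row)

theorem isSelfDual_code94 : IsSelfDual code94 := isSelfDual_code mul_transpose

theorem finrank_code94 : Module.finrank (ZMod 2) code94 = 47 := finrank_code (maskMatrix row)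

theorem natCard_code94 : Nat.card code94 = 2 ^ 47 := natCard_code (maskMatrix row)

/-- A vector in the shadow of the code. -/
def shadow : Fin 94 → ZMod 2 :=
  (Fin.append 0 (vec shadowMask : Fin 47 → ZMod 2) : Fin (47 + 47) → ZMod 2)

theorem cosetCount_shadow_3 : cosetCount code94 shadow 3 = 0 :=
  cosetCount_eq _ _ shadowMask_vecMul total_rows_shadow_3 total_cols_shadow_3 rfl

theorem cosetCount_shadow_7 : cosetCount code94 shadow 7 = 0 :=
  cosetCount_eq _ _ shadowMask_vecMul total_rows_shadow_7 total_cols_shadow_7 rfl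

theorem cosetCount_shadow_11 : cosetCount code94 shadow 11 = 92 :=
  cosetCount_eq _ _ shadowMask_vecMul total_rows_shadow_11 total_cols_shadow_11 rfl

theorem cosetCount_shadow_15 : cosetCount code94 shadow 15 = 2990 :=
  cosetCount_eq _ _ shadowMask_vecMul total_rows_shadow_15 total_cols_shadow_15 rfl

theorem cosetCount_low {i : ℕ} (h0 : 0 < i) (h : i < 8) : cosetCount code94 0 (2 * i) = 0 := by
  interval_cases i
  · exact cosetCount_zero_eq_zero total_rows_2 total_cols_2 rfl
  · exact cosetCount_zero_eq_zero total_rows_4 total_cols_4 rfl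
  · exact cosetCount_zero_eq_zero total_rows_6 total_cols_6 rfl
  · exact cosetCount_zero_eq_zero total_rows_8 total_cols_8 rfl
  · exact cosetCount_zero_eq_zero total_rows_10 total_cols_10 rfl
  · exact cosetCount_zero_eq_zero total_rows_12 total_cols_12 rfl
  · exact cosetCount_zero_eq_zero total_rows_14 total_cols_14 rfl

theorem sum_range_ninety_five (f : ℕ → ℤ) :
    ∑ j ∈ Finset.range 95, cosetCount code94 0 j * f j = f 0 + f 94 +
      ∑ i : Fin 16, cosetCount code94 0 (16 + 2 * i) * (f (16 + 2 * i) + f (78 - 2 * i)) := by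
  have hs := isSelfDual_code94
  have h0 : cosetCount code94 0 0 = 1 := cosetCount_zero_zero
  have hodd (j : ℕ) (hj : j % 2 = 1) : cosetCount code94 0 j = 0 := by
    rw [← Nat.div_add_mod j 2, hj]
    exact hs.cosetCount_odd (by simp)
  have hlow (j : ℕ) (h : 0 < j) (hj : j < 16) : cosetCount code94 0 j = 0 := by
    obtain h2 | h2 := Nat.mod_two_eq_zero_or_one j
    · obtain ⟨i, rfl⟩ := Nat.dvd_of_mod_eq_zero h2
      exact cosetCount_low (by omega) (by omega)
    · exact hodd j h2
  have hsymm (j : ℕ) (h : 47 < j) (hj : j ≤ 94) :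
      cosetCount code94 0 j = cosetCount code94 0 (94 - j) := (hs.cosetCount_sub hj).symm
  generalize cosetCount code94 0 = N at *
  simp [Finset.sum_range_succ, Fin.sum_univ_succ, hodd, hlow, hsymm, h0]
  ring

/-- A linear combination of the coefficients in the MacWilliams identities for the code and for its
shadow. -/
def combination (l : Fin 12 → ℤ) (s : Fin 4 → ℤ) (j : ℕ) : ℤ :=
  ∑ i, l i * (krawtchouk (94 - j) j (2 * i) - if j = 2 * i then 2 ^ 47 else 0) +
    ∑ i, s i * ((-1) ^ (j / 2) * krawtchouk (94 - j) j (4 * i + 3))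

theorem sum_combination (l : Fin 12 → ℤ) (s : Fin 4 → ℤ) :
    ∑ j ∈ Finset.range 95, cosetCount code94 0 j * combination l s j =
      2 ^ 47 * (92 * s 2 + 2990 * s 3) := by
  have h1 (i : Fin 12) : ∑ j ∈ Finset.range 95, cosetCount code94 0 j *
      (krawtchouk (94 - j) j (2 * i) - if j = 2 * i then 2 ^ 47 else 0) = 0 := by
    have hi : 2 * i.val < 95 := by omega
    simp only [mul_sub, Finset.sum_sub_distrib, isSelfDual_code94.sum_krawtchouk (m := 94),
      natCard_code94, mul_ite, mul_zero, Finset.sum_ite_eq', Finset.mem_range, hi, if_true]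
    push_cast
    ring
  have h2 (i : Fin 4) : ∑ j ∈ Finset.range 95, cosetCount code94 0 j *
      ((-1) ^ (j / 2) * krawtchouk (94 - j) j (4 * i + 3)) =
        2 ^ 47 * cosetCount code94 shadow (4 * i + 3) := by
    have h := isSelfDual_code94.sum_krawtchouk_shadow (fun c hc => four_dvd hc) (4 * i + 3)
    rw [natCard_code94] at h
    exact_mod_cast h
  have h3 : ∑ i : Fin 4, s i * cosetCount code94 shadow (4 * i + 3) = 92 * s 2 + 2990 * s 3 := by
    simp [Fin.sum_univ_four, cosetCount_shadow_3, cosetCount_shadow_7, cosetCount_shadow_11,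
      cosetCount_shadow_15, mul_comm]
  simp only [combination, mul_add, Finset.mul_sum, Finset.sum_add_distrib]
  rw [Finset.sum_comm, Finset.sum_comm (t := (Finset.univ : Finset (Fin 4)))]
  simp only [mul_left_comm (cosetCount _ _ _ : ℤ) (l _), mul_left_comm (cosetCount _ _ _ : ℤ) (s _),
    ← Finset.mul_sum, h1, h2, mul_zero, Finset.sum_const_zero, zero_add]
  rw [← mul_add, ← h3, Finset.mul_sum]
  exact Finset.sum_congr rfl fun i _ => mul_left_comm _ _ _

theorem cosetCount_of_combination (l : Fin 12 → ℤ) (s : Fin 4 → ℤ) (i : Fin 16) (v : ℤ)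
    (h : ∀ j : Fin 16, combination l s (16 + 2 * j) + combination l s (78 - 2 * j) =
      if j = i then 2 ^ 48 else 0)
    (hv : combination l s 0 + combination l s 94 + 2 ^ 48 * v =
      2 ^ 47 * (92 * s 2 + 2990 * s 3)) :
    (cosetCount code94 0 (16 + 2 * i) : ℤ) = v := by
  have h1 := sum_combination l s
  simp only [sum_range_ninety_five, h, mul_ite, mul_zero, Finset.sum_ite_eq',
    Finset.mem_univ, if_true] at h1
  linarith

theorem cosetCount_16 : (cosetCount code94 0 16 : ℤ) = 9292 :=
  cosetCount_of_combination
    ![0, 4692, -204, 748, -68, 84, -12, 5, -1, 0, 0, 0]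
    ![4488, 680, 72, 4] 0 9292 (by decide +kernel) (by decide +kernel)

theorem cosetCount_18 : (cosetCount code94 0 18 : ℤ) = 112976 :=
  cosetCount_of_combination
    ![134044, 45448, 17780, 4732, 1628, 260, 77, -4, 0, -1, 0, 0]
    ![-57992, -5800, -328, -4] 1 112976 (by decide +kernel) (by decide +kernel)

theorem cosetCount_20 : (cosetCount code94 0 20 : ℤ) = 1953712 :=
  cosetCount_of_combination
    ![2010660, 589628, 199248, 41412, 12772, 981, 396, -60, 0, 0, -1, 0]
    ![667656, 42024, 712, -60] 2 1953712 (by decide +kernel) (by decide +kernel)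

theorem le_wt {x : Fin 94 → ZMod 2} (hx : x ∈ code94) (h0 : x ≠ 0) : 16 ≤ wt x := by
  by_contra! h
  obtain ⟨i, hi⟩ := (isSelfDual_code94.even_wt hx).two_dvd
  have h1 : wt x ≠ 0 := mt wt_eq_zero.1 h0
  have h2 : cosetCount code94 0 (wt x) = 0 := by
    rw [hi]
    exact cosetCount_low (by omega) (by omega)
  rw [cosetCount, Set.ncard_eq_zero, Set.eq_empty_iff_forall_notMem] at h2
  exact h2 x ⟨by rwa [add_zero], rfl⟩

theorem ncard_eq_cosetCount (k : ℕ) :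
    {x | x ∈ code94 ∧ wt x = k}.ncard = cosetCount code94 0 k := by
  simp only [cosetCount, add_zero]

end Code94

/-- There exists a binary self-dual `[94, 47, 16]` code with
`A₁₆ = 2α`, `A₁₈ = 134044 - 2α + 128β` and `A₂₀ = 2010660 - 30α - 896β`
for `α = 4646` and `β = -92` (weight enumerator `W₉₄,₁`). -/
theorem exists_self_dual_94_47_16 :
    ∃ C : Submodule (ZMod 2) (Fin 94 → ZMod 2),
      (∀ x, x ∈ C ↔ ∀ y ∈ C, ∑ i, x i * y i = 0) ∧
      Module.finrank (ZMod 2) C = 47 ∧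
      (∀ x ∈ C, x ≠ 0 → 16 ≤ wt x) ∧
      (∃ x ∈ C, x ≠ 0 ∧ wt x = 16) ∧
      ({x | x ∈ C ∧ wt x = 16}.ncard : ℤ) = 2 * 4646 ∧
      ({x | x ∈ C ∧ wt x = 18}.ncard : ℤ) = 134044 - 2 * 4646 + 128 * (-92) ∧
      ({x | x ∈ C ∧ wt x = 20}.ncard : ℤ) = 2010660 - 30 * 4646 - 896 * (-92) := by
  refine ⟨Code94.code94, Code94.isSelfDual_code94, Code94.finrank_code94,
    fun _ hx h0 => Code94.le_wt hx h0, ?_, ?_, ?_, ?_⟩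
  · have h : {x | x ∈ Code94.code94 ∧ wt x = 16}.ncard ≠ 0 := by
      rw [Code94.ncard_eq_cosetCount]
      have := Code94.cosetCount_16
      omega
    obtain ⟨x, hx, hw⟩ := Set.nonempty_of_ncard_ne_zero h
    exact ⟨x, hx, fun h0 => by simp [h0, wt] at hw, hw⟩
  · rw [Code94.ncard_eq_cosetCount, Code94.cosetCount_16]
    norm_num
  · rw [Code94.ncard_eq_cosetCount, Code94.cosetCount_18]
    norm_num
  · rw [Code94.ncard_eq_cosetCount, Code94.cosetCount_20]
    norm_num
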